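/- arXiv:2012.04019 — 2 statements merged into one kernel-verified Lean document; each statement's English description precedes it below -/
import Mathlib

section
/- For all integers m ≥ 2, n ≥ 8m, and 0 ≤ k ≤ m, the probability that exactly k of the m copies of the symbol '1' appear among the first ⌊mn/2⌋ positions of a uniformly random element of S_{m,n} satisfies Pr[K_1(π̄) = k] ≥ (1/2)·2^{−m}·C(m,k). -/
open Finset

/-- `DeckSet m n` : words of length `m*n` over alphabet `Fin n` (symbol `i` models card
type `i+1`) in which every symbol occurs exactly `m` times. -/
def DeckSet (m n : ℕ) : Finset (Fin (m * n) → Fin n) :=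
  Finset.univ.filter fun π => ∀ v : Fin n, (Finset.univ.filter fun t => π t = v).card = m

/-- Feedback history: `feedback G π t` is the list of Yes/No bits received after the
first `t` guesses when playing strategy `G` against deck `π`. -/
def feedback {n N : ℕ} (G : List Bool → Fin n) (π : Fin N → Fin n) : ℕ → List Bool
  | 0 => []
  | t + 1 =>
      feedback G π t ++
        [if h : t < N then decide (G (feedback G π t) = π ⟨t, h⟩) else false]

/-- Score of the deterministic Yes/No-feedback strategy `G` against the deck `π`:
the number of positions `t` where the guess `G (feedback G π t)` equals `π t`. -/
def guessScore {n N : ℕ} (G : List Bool → Fin n) (π : Fin N → Fin n) : ℕ :=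
  (Finset.univ.filter fun t : Fin N => G (feedback G π t.1) = π t).card

/-- `K1count m n π` : the number of positions `t ≤ ⌊mn/2⌋` (1-indexed; equivalently
0-indexed `t < ⌊mn/2⌋`) holding the symbol `1` (modeled by `0 : Fin n`). -/
def K1count (m n : ℕ) (π : Fin (m * n) → Fin n) : ℕ :=
  (Finset.univ.filter fun t : Fin (m * n) => t.1 < m * n / 2 ∧ (π t).1 = 0).card

/-- `K2count m n π` : the number of positions `t > ⌊mn/2⌋` (1-indexed; equivalently
0-indexed `t ≥ ⌊mn/2⌋`) holding the symbol `2` (modeled by `1 : Fin n`). -/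
def K2count (m n : ℕ) (π : Fin (m * n) → Fin n) : ℕ :=
  (Finset.univ.filter fun t : Fin (m * n) => m * n / 2 ≤ t.1 ∧ (π t).1 = 1).card

/-- Rearranging the positions of a deck gives a deck. -/
lemma comp_perm_mem_DeckSet {m n : ℕ} {π : Fin (m * n) → Fin n} (hπ : π ∈ DeckSet m n)
    (σ : Equiv.Perm (Fin (m * n))) : π ∘ σ ∈ DeckSet m n := by
  simp only [DeckSet, mem_filter, mem_univ, true_and] at hπ ⊢
  intro v
  exact (card_equiv σ (by simp)).trans (hπ v)

lemma DeckSet_nonempty (m n : ℕ) : (DeckSet m n).Nonempty := by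
  refine ⟨fun t => (finProdFinEquiv.symm t).2, ?_⟩
  simp only [DeckSet, mem_filter, mem_univ, true_and]
  intro v
  have h : #{t : Fin (m * n) | (finProdFinEquiv.symm t).2 = v}
      = #((univ : Finset (Fin m)) ×ˢ ({v} : Finset (Fin n))) :=
    card_equiv finProdFinEquiv.symm (by simp [eq_comm])
  rw [h]
  simp

/-- The number of decks in which a given symbol occupies the set `S` of positions depends only on
the cardinality of `S`; one inequality suffices by symmetry. -/
lemma card_DeckSet_positions_le {m n : ℕ} (v : Fin n) {S T : Finset (Fin (m * n))}
    (h : #S = #T) :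
    #{π ∈ DeckSet m n | ({t | π t = v} : Finset (Fin (m * n))) = S} ≤
      #{π ∈ DeckSet m n | ({t | π t = v} : Finset (Fin (m * n))) = T} := by
  let e : {x // x ∈ T} ≃ {x // x ∈ S} := Finset.equivOfCardEq h.symm
  let σ : Equiv.Perm (Fin (m * n)) := e.extendSubtype
  have hσ : ∀ x, σ x ∈ S ↔ x ∈ T := fun x =>
    ⟨fun hx => by_contra fun hx' => e.extendSubtype_not_mem x hx' hx,
      fun hx => e.extendSubtype_mem x hx⟩
  refine card_le_card_of_injOn (fun π => π ∘ σ) ?_ ?_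
  · intro π hπ
    simp only [coe_filter, Set.mem_ofPred_eq] at hπ ⊢
    refine ⟨comp_perm_mem_DeckSet hπ.1 σ, ?_⟩
    ext x
    rw [← hσ x, ← hπ.2]
    simp
  · intro π _ ρ _ h
    exact σ.surjective.injective_comp_right h

lemma card_DeckSet_positions_eq {m n : ℕ} (v : Fin n) {S T : Finset (Fin (m * n))}
    (h : #S = #T) :
    #{π ∈ DeckSet m n | ({t | π t = v} : Finset (Fin (m * n))) = S} =
      #{π ∈ DeckSet m n | ({t | π t = v} : Finset (Fin (m * n))) = T} :=
  (card_DeckSet_positions_le v h).antisymm (card_DeckSet_positions_le v h.symm)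

/-- The positions of a given symbol in a uniform deck form a uniform `m`-subset. -/
lemma card_DeckSet_filter_mul_choose {m n : ℕ} (v : Fin n) (p : Finset (Fin (m * n)) → Prop)
    [DecidablePred p] :
    #{π ∈ DeckSet m n | p {t | π t = v}} * (m * n).choose m =
      #{S ∈ powersetCard m (univ : Finset (Fin (m * n))) | p S} * #(DeckSet m n) := by
  obtain ⟨π₀, hπ₀⟩ := DeckSet_nonempty m n
  have hcard : ∀ π ∈ DeckSet m n, #{t | π t = v} = m := fun π hπ => by
    simp only [DeckSet, mem_filter, mem_univ, true_and] at hπ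
    exact hπ v
  set c := #{π ∈ DeckSet m n | ({t | π t = v} : Finset (Fin (m * n))) =
    ({t | π₀ t = v} : Finset (Fin (m * n)))} with hc
  have key : ∀ (q : Finset (Fin (m * n)) → Prop) [DecidablePred q],
      #{π ∈ DeckSet m n | q {t | π t = v}} =
        #{S ∈ powersetCard m (univ : Finset (Fin (m * n))) | q S} * c := by
    intro q _
    rw [card_eq_sum_card_fiberwise (f := fun π => ({t | π t = v} : Finset (Fin (m * n))))
      (t := {S ∈ powersetCard m (univ : Finset (Fin (m * n))) | q S})]
    · refine sum_const_nat fun S hS => ?_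
      simp only [mem_filter, mem_powersetCard, subset_univ, true_and] at hS
      rw [hc, ← card_DeckSet_positions_eq v (hS.1.trans (hcard π₀ hπ₀).symm), filter_filter]
      congr 1
      refine filter_congr fun π _ => ⟨fun h => h.2, fun h => ⟨h ▸ hS.2, h⟩⟩
    · intro π hπ
      simp only [coe_filter, Set.mem_ofPred_eq, mem_powersetCard, subset_univ, true_and] at hπ ⊢
      exact ⟨hcard π hπ.1, hπ.2⟩
  have hall := key fun _ => True
  simp only [filter_true, card_powersetCard, card_univ, Fintype.card_fin] at hall
  rw [key p, hall]
  ring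

/-- There are at least `C(h,k) C(N-h,m-k)` sets of size `m` having `k` elements below `h`. -/
lemma choose_mul_choose_le_card_filter {N h m k : ℕ} (hh : h ≤ N) (hk : k ≤ m) :
    h.choose k * (N - h).choose (m - k) ≤
      #{S ∈ powersetCard m (univ : Finset (Fin N)) | #{t ∈ S | t.1 < h} = k} := by
  let L : Finset (Fin N) := {t | t.1 < h}
  have hL : #L = h := by
    rw [Fin.card_filter_val_lt]
    exact min_eq_right hh
  have hR : #Lᶜ = N - h := by rw [card_compl, hL, Fintype.card_fin]
  have hdisj : ∀ B ⊆ Lᶜ, Disjoint L B := fun B hB =>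
    disjoint_compl_right.mono_right hB
  have hlow : ∀ A ⊆ L, ∀ B ⊆ Lᶜ, (A ∪ B) ∩ L = A := fun A hA B hB => by
    rw [union_inter_distrib_right, inter_eq_left.2 hA,
      disjoint_iff_inter_eq_empty.1 (hdisj B hB).symm, union_empty]
  have hhigh : ∀ A ⊆ L, ∀ B ⊆ Lᶜ, (A ∪ B) \ L = B := fun A hA B hB => by
    rw [union_sdiff_distrib, sdiff_eq_empty_iff_subset.2 hA,
      sdiff_eq_self_of_disjoint (hdisj B hB).symm, empty_union]
  calc h.choose k * (N - h).choose (m - k)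
      = #(powersetCard k L ×ˢ powersetCard (m - k) Lᶜ) := by
        rw [card_product, card_powersetCard, card_powersetCard, hL, hR]
    _ ≤ _ := by
        refine card_le_card_of_injOn (fun P => P.1 ∪ P.2) ?_ ?_
        · rintro ⟨A, B⟩ hAB
          simp only [mem_coe, mem_product, mem_powersetCard, mem_filter, subset_univ,
            true_and] at hAB ⊢
          obtain ⟨⟨hA, hAk⟩, hB, hBk⟩ := hAB
          constructor
          · rw [card_union_of_disjoint ((hdisj B hB).mono_left hA)]
            omega
          · have hf : {t ∈ A ∪ B | t.1 < h} = (A ∪ B) ∩ L := by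
              ext t
              simp [L]
            rw [hf, hlow A hA B hB, hAk]
        · rintro ⟨A, B⟩ hAB ⟨A', B'⟩ hAB' heq
          simp only [mem_coe, mem_product, mem_powersetCard] at hAB hAB' heq
          have h₁ : A = A' := by
            rw [← hlow A hAB.1.1 B hAB.2.1, heq, hlow A' hAB'.1.1 B' hAB'.2.1]
          have h₂ : B = B' := by
            rw [← hhigh A hAB.1.1 B hAB.2.1, heq, hhigh A' hAB'.1.1 B' hAB'.2.1]
          rw [h₁, h₂]

/-- Bernoulli's inequality in the form used to compare hypergeometric and binomial weights. -/
lemma pow_le_two_mul_sub_pow {N m : ℕ} (h : 8 * m * m ≤ N) (hm : 0 < m) :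
    N ^ m ≤ 2 * (N - 2 * m) ^ m := by
  have hmN : 2 * m ≤ N := by nlinarith
  have hN : (0 : ℝ) < N := by
    have : 0 < N := by omega
    exact_mod_cast this
  have h' : (8 : ℝ) * m * m ≤ N := by exact_mod_cast h
  have hmN' : (2 : ℝ) * m ≤ N := by exact_mod_cast hmN
  have hx : 2 * (m : ℝ) / N ≤ 1 := (div_le_one hN).2 hmN'
  have hb := one_add_mul_le_pow (a := -(2 * (m : ℝ) / N)) (by linarith) m
  have hq : (m : ℝ) * (2 * m / N) ≤ 1 / 2 := by
    rw [← mul_div_assoc, div_le_iff₀ hN]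
    linarith [mul_nonneg (Nat.cast_nonneg (α := ℝ) m) (Nat.cast_nonneg (α := ℝ) m)]
  have hhalf : (1 : ℝ) / 2 ≤ (1 + -(2 * (m : ℝ) / N)) ^ m := by linarith
  have heq : ((N : ℝ) - 2 * m) = N * (1 + -(2 * (m : ℝ) / N)) := by
    field_simp
    ring
  have : (N : ℝ) ^ m ≤ 2 * ((N : ℝ) - 2 * m) ^ m := by
    rw [heq, mul_pow]
    nlinarith [pow_pos hN m]
  rw [← Nat.cast_le (α := ℝ)]
  push_cast [Nat.cast_sub hmN]
  exact this

lemma choose_mul_choose_half_bound {N m k : ℕ} (h : 8 * m * m ≤ N) (hm : 0 < m) (hk : k ≤ m) :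
    m.choose k * N.choose m ≤
      2 ^ (m + 1) * ((N / 2).choose k * (N - N / 2).choose (m - k)) := by
  have hmN : 8 * m ≤ N := by nlinarith
  have hA : (N - 2 * m) ^ k ≤ 2 ^ k * (N / 2).descFactorial k := by
    calc (N - 2 * m) ^ k ≤ (2 * (N / 2 + 1 - k)) ^ k := Nat.pow_le_pow_left (by omega) k
      _ = 2 ^ k * (N / 2 + 1 - k) ^ k := mul_pow ..
      _ ≤ _ := Nat.mul_le_mul_left _ (Nat.pow_sub_le_descFactorial _ _)
  have hB : (N - 2 * m) ^ (m - k) ≤ 2 ^ (m - k) * (N - N / 2).descFactorial (m - k) := by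
    calc (N - 2 * m) ^ (m - k) ≤ (2 * (N - N / 2 + 1 - (m - k))) ^ (m - k) :=
          Nat.pow_le_pow_left (by omega) _
      _ = 2 ^ (m - k) * (N - N / 2 + 1 - (m - k)) ^ (m - k) := mul_pow ..
      _ ≤ _ := Nat.mul_le_mul_left _ (Nat.pow_sub_le_descFactorial _ _)
  have hpos : 0 < k.factorial * (m - k).factorial := by positivity
  refine Nat.le_of_mul_le_mul_left ?_ hpos
  calc k.factorial * (m - k).factorial * (m.choose k * N.choose m)
      = m.choose k * k.factorial * (m - k).factorial * N.choose m := by ring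
    _ = N.descFactorial m := by
        rw [Nat.choose_mul_factorial_mul_factorial hk, Nat.descFactorial_eq_factorial_mul_choose]
    _ ≤ N ^ m := Nat.descFactorial_le_pow _ _
    _ ≤ 2 * (N - 2 * m) ^ m := pow_le_two_mul_sub_pow h hm
    _ = 2 * ((N - 2 * m) ^ k * (N - 2 * m) ^ (m - k)) := by
        rw [← pow_add, Nat.add_sub_cancel' hk]
    _ ≤ 2 * ((2 ^ k * (N / 2).descFactorial k) *
          (2 ^ (m - k) * (N - N / 2).descFactorial (m - k))) := by gcongr
    _ = 2 * (2 ^ k * 2 ^ (m - k)) * ((N / 2).descFactorial k *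
          (N - N / 2).descFactorial (m - k)) := by ring
    _ = _ := by
        rw [← pow_add, Nat.add_sub_cancel' hk, Nat.descFactorial_eq_factorial_mul_choose,
          Nat.descFactorial_eq_factorial_mul_choose]
        ring

/-- For `m ≥ 2`, `n ≥ 8m` and `0 ≤ k ≤ m`, the probability that exactly `k` of the `m`
copies of the symbol `1` lie among the first `⌊mn/2⌋` positions of a uniform deck of
`S_{m,n}` is at least `(1/2) · 2^{-m} · C(m,k)`. -/
theorem K1_anticoncentration (m n k : ℕ) (hm : 2 ≤ m) (hn : 8 * m ≤ n) (hk : k ≤ m) :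
    (1 / 2 : ℝ) * ((m.choose k : ℝ) / 2 ^ m) ≤
      (((DeckSet m n).filter fun π => K1count m n π = k).card : ℝ) / (DeckSet m n).card := by
  let v : Fin n := ⟨0, by omega⟩
  have hcount := card_DeckSet_filter_mul_choose (m := m) v fun S => #{t ∈ S | t.1 < m * n / 2} = k
  have hfilter : ((DeckSet m n).filter fun π => K1count m n π = k) =
      {π ∈ DeckSet m n | #{t ∈ ({t | π t = v} : Finset _) | t.1 < m * n / 2} = k} := by
    refine filter_congr fun π _ => ?_
    simp only [K1count, filter_filter, v, Fin.ext_iff, and_comm]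
  rw [← hfilter] at hcount
  have hsub := choose_mul_choose_le_card_filter (Nat.div_le_self (m * n) 2) hk
  have hbound := choose_mul_choose_half_bound (N := m * n) (by nlinarith) (by omega) hk
  have hD : 0 < #(DeckSet m n) := (DeckSet_nonempty m n).card_pos
  have hC : 0 < (m * n).choose m := Nat.choose_pos (by nlinarith)
  have hmain : m.choose k * #(DeckSet m n) ≤
      2 ^ (m + 1) * #((DeckSet m n).filter fun π => K1count m n π = k) := by
    refine Nat.le_of_mul_le_mul_right ?_ hC
    calc m.choose k * #(DeckSet m n) * (m * n).choose m
        = m.choose k * (m * n).choose m * #(DeckSet m n) := by ring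
      _ ≤ 2 ^ (m + 1) * #{S ∈ powersetCard m (univ : Finset (Fin (m * n))) |
            #{t ∈ S | t.1 < m * n / 2} = k} * #(DeckSet m n) :=
          Nat.mul_le_mul_right _ (hbound.trans (Nat.mul_le_mul_left _ hsub))
      _ = _ := by rw [mul_assoc, ← hcount, mul_assoc]
  rw [le_div_iff₀ (by exact_mod_cast hD)]
  have hmain' : (m.choose k : ℝ) * #(DeckSet m n) ≤
      2 ^ (m + 1) * #((DeckSet m n).filter fun π => K1count m n π = k) := by exact_mod_cast hmain
  have h2 : (0 : ℝ) < 2 ^ (m + 1) := by positivity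
  calc (1 / 2 : ℝ) * ((m.choose k : ℝ) / 2 ^ m) * #(DeckSet m n)
      = (m.choose k : ℝ) * #(DeckSet m n) / 2 ^ (m + 1) := by rw [pow_succ]; field_simp
    _ ≤ _ := by rwa [div_le_iff₀' h2]
end

section
/- For all positive integers m and n and every deterministic strategy G with Yes/No feedback, Pr[S(A, π̄) = 0] ≥ Pr[S(G, π̄) = 0], where π̄ is a uniformly random element of S_{m,n}; that is, the avoiding strategy maximizes the probability of scoring zero. -/
open Finset

/-- Score of the avoiding strategy on deck `π` (0-indexed positions, symbol `i : Fin n`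
models card type `i+1`): guess `1, 2, …, n, 1, 2, …` (i.e. symbol `t % n` at time `t`)
until the first correct guess, at position `f`; thereafter guess `π f` forever.  The
score is `0` if no guess in the first phase is ever correct, and otherwise
`1 + #{s : f < s, π s = π f}`. -/
def avoidScore (m n : ℕ) (π : Fin (m * n) → Fin n) : ℕ :=
  if h : (Finset.univ.filter fun t : Fin (m * n) => (π t).1 = t.1 % n).Nonempty then
    1 + (Finset.univ.filter fun s : Fin (m * n) =>
        (Finset.univ.filter fun t : Fin (m * n) => (π t).1 = t.1 % n).min' h < s ∧
        π s = π ((Finset.univ.filter fun t : Fin (m * n) => (π t).1 = t.1 % n).min' h)).card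
  else 0

/-- `firstHit m n π` is the 1-indexed position of the first correct guess made by the
avoiding strategy on deck `π` (i.e. the least `t` with `π_t = ((t-1) mod n) + 1`),
and `0` if there is none (`f(π) = ∞`). -/
def firstHit (m n : ℕ) (π : Fin (m * n) → Fin n) : ℕ :=
  if h : (Finset.univ.filter fun t : Fin (m * n) => (π t).1 = t.1 % n).Nonempty then
    ((Finset.univ.filter fun t : Fin (m * n) => (π t).1 = t.1 % n).min' h).1 + 1
  else 0

open MvPolynomial in
/-- A polynomial that is antisymmetric under exchanging the variables `i` and `j`, and whose
monomials with a larger exponent at `i` than at `j` have nonnegative coefficients. -/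
structure SkewNonneg {n : ℕ} (i j : Fin n) (R : MvPolynomial (Fin n) ℤ) : Prop where
  rename_swap : rename (Equiv.swap i j) R = -R
  coeff_nonneg : ∀ d : Fin n →₀ ℕ, d j < d i → 0 ≤ coeff d R

namespace SkewNonneg

open MvPolynomial

variable {n : ℕ} {i j : Fin n} {R R' : MvPolynomial (Fin n) ℤ}

lemma coeff_nonneg_of_le (hR : SkewNonneg i j R) {d : Fin n →₀ ℕ} (hd : d j ≤ d i) :
    0 ≤ coeff d R := by
  rcases hd.lt_or_eq with h | h
  · exact hR.coeff_nonneg d h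
  · have hmap : d.mapDomain (Equiv.swap i j) = d := by
      ext k
      have := Finsupp.mapDomain_apply (Equiv.swap i j).injective d (Equiv.swap i j k)
      rw [Equiv.swap_apply_self] at this
      rw [this]
      rcases eq_or_ne k i with rfl | hki
      · simp [h]
      · rcases eq_or_ne k j with rfl | hkj
        · simp [h]
        · rw [Equiv.swap_apply_of_ne_of_ne hki hkj]
    have := coeff_rename_mapDomain (Equiv.swap i j) (Equiv.swap i j).injective R d
    rw [hmap, hR.rename_swap, coeff_neg] at this
    omega

lemma zero : SkewNonneg i j (0 : MvPolynomial (Fin n) ℤ) := ⟨by simp, by simp⟩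

lemma add (hR : SkewNonneg i j R) (hR' : SkewNonneg i j R') : SkewNonneg i j (R + R') where
  rename_swap := by rw [map_add, hR.rename_swap, hR'.rename_swap]; ring
  coeff_nonneg d hd := by
    rw [coeff_add]
    exact add_nonneg (hR.coeff_nonneg d hd) (hR'.coeff_nonneg d hd)

lemma mul_X (hR : SkewNonneg i j R) {k : Fin n} (hki : k ≠ i) (hkj : k ≠ j) :
    SkewNonneg i j (R * X k) where
  rename_swap := by
    rw [map_mul, hR.rename_swap, rename_X, Equiv.swap_apply_of_ne_of_ne hki hkj]; ring
  coeff_nonneg d hd := by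
    rw [coeff_mul_X']
    split_ifs
    · exact hR.coeff_nonneg _ (by simpa [Finsupp.single_apply, hki, hkj] using hd)
    · exact le_rfl

lemma mul_sum_X (hR : SkewNonneg i j R) (s : Finset (Fin n)) (hi : i ∉ s) (hj : j ∉ s) :
    SkewNonneg i j (R * ∑ k ∈ s, X k) := by
  rw [Finset.mul_sum]
  refine Finset.sum_induction _ (SkewNonneg i j) (fun _ _ h h' => h.add h') zero fun k hk => ?_
  exact hR.mul_X (fun h => hi (h ▸ hk)) (fun h => hj (h ▸ hk))

lemma mul_X_add_X (hij : i ≠ j) (hR : SkewNonneg i j R) : SkewNonneg i j (R * (X i + X j)) where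
  rename_swap := by
    rw [map_mul, hR.rename_swap, map_add, rename_X, rename_X, Equiv.swap_apply_left,
      Equiv.swap_apply_right]
    ring
  coeff_nonneg d hd := by
    rw [mul_add, coeff_add, coeff_mul_X', coeff_mul_X']
    refine add_nonneg ?_ ?_
    · split_ifs
      · exact hR.coeff_nonneg_of_le (by simp [hij]; omega)
      · exact le_rfl
    · split_ifs
      · exact hR.coeff_nonneg_of_le (by simp [hij.symm]; omega)
      · exact le_rfl

lemma mul_X_mul_X (hij : i ≠ j) (hR : SkewNonneg i j R) : SkewNonneg i j (R * (X i * X j)) where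
  rename_swap := by
    rw [map_mul, hR.rename_swap, map_mul, rename_X, rename_X, Equiv.swap_apply_left,
      Equiv.swap_apply_right]
    ring
  coeff_nonneg d hd := by
    rw [← mul_assoc, coeff_mul_X', coeff_mul_X']
    split_ifs
    · exact hR.coeff_nonneg_of_le (by simp [hij, hij.symm]; omega)
    · exact le_rfl
    · exact le_rfl

lemma X_sub_X (hij : i ≠ j) : SkewNonneg i j (X i - X j : MvPolynomial (Fin n) ℤ) where
  rename_swap := by simp
  coeff_nonneg d hd := by
    rw [coeff_sub, coeff_X, coeff_X, if_neg (c := Finsupp.single j 1 = d), sub_zero]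
    · split_ifs <;> simp
    · rintro rfl
      simp [hij.symm] at hd

lemma mul_pow {P : MvPolynomial (Fin n) ℤ}
    (hP : ∀ R, SkewNonneg i j R → SkewNonneg i j (R * P)) (hR : SkewNonneg i j R) (k : ℕ) :
    SkewNonneg i j (R * P ^ k) := by
  induction k with
  | zero => simpa using hR
  | succ k ih => rw [pow_succ, ← mul_assoc]; exact hP _ ih

lemma mul_prod {ι : Type*} (s : Finset ι) {P : ι → MvPolynomial (Fin n) ℤ}
    (hP : ∀ v ∈ s, ∀ R, SkewNonneg i j R → SkewNonneg i j (R * P v)) (hR : SkewNonneg i j R) :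
    SkewNonneg i j (R * ∏ v ∈ s, P v) := by
  classical
  induction s using Finset.induction_on with
  | empty => simpa using hR
  | insert a s ha ih =>
    rw [Finset.prod_insert ha, mul_left_comm, mul_comm]
    exact hP a (Finset.mem_insert_self a s) _
      (ih fun v hv => hP v (Finset.mem_insert_of_mem hv))

end SkewNonneg

namespace MvPolynomial

variable {n : ℕ}

/-- The sum of all variables other than `v`. -/
noncomputable def sumXErase (v : Fin n) : MvPolynomial (Fin n) ℤ :=
  ∑ k ∈ Finset.univ.erase v, X k

/-- The product of the polynomials `sumXErase v`, raised to multiplicities `c v`: its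
coefficients count the words avoiding any fixed word that has `c v` letters `v`. -/
noncomputable def avoidPoly (c : Fin n → ℕ) : MvPolynomial (Fin n) ℤ :=
  ∏ v, sumXErase v ^ c v

lemma sumXErase_eq {u v : Fin n} (huv : u ≠ v) :
    sumXErase u = ∑ k ∈ (Finset.univ.erase u).erase v, X k + X v :=
  (Finset.sum_erase_add _ _ (by simp [huv.symm])).symm

lemma coeff_mul_sumXErase_pow_nonneg {i j : Fin n}
    {R : MvPolynomial (Fin n) ℤ} (hR : ∀ d : Fin n →₀ ℕ, d j ≤ d i → 0 ≤ coeff d R) (e : ℕ) :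
    ∀ d : Fin n →₀ ℕ, d j ≤ d i → 0 ≤ coeff d (R * sumXErase i ^ e) := by
  induction e with
  | zero => simpa using hR
  | succ e ih =>
    intro d hd
    rw [pow_succ, ← mul_assoc]
    nth_rw 2 [sumXErase]
    rw [Finset.mul_sum, coeff_sum]
    refine Finset.sum_nonneg fun k hk => ?_
    rw [coeff_mul_X']
    split_ifs
    · refine ih _ ?_
      have hki : k ≠ i := (Finset.mem_erase.mp hk).1
      simp only [Finsupp.coe_tsub, Pi.sub_apply, Finsupp.single_apply, if_neg hki]
      omega
    · exact le_rfl

lemma skewNonneg_mul_sumXErase {i j v : Fin n} (hij : i ≠ j) (hvi : v ≠ i) (hvj : v ≠ j)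
    {R : MvPolynomial (Fin n) ℤ} (hR : SkewNonneg i j R) :
    SkewNonneg i j (R * sumXErase v) := by
  have : (sumXErase v : MvPolynomial (Fin n) ℤ) =
      ∑ k ∈ ((Finset.univ.erase v).erase i).erase j, X k + (X i + X j) := by
    rw [sumXErase_eq hvi, ← Finset.sum_erase_add _ _
      (show j ∈ (Finset.univ.erase v).erase i by simp [hij.symm, hvj.symm])]
    ring
  rw [this, mul_add]
  exact (hR.mul_sum_X _ (by simp) (by simp)).add (hR.mul_X_add_X hij)

lemma skewNonneg_mul_sumXErase_mul_sumXErase {i j : Fin n} (hij : i ≠ j)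
    {R : MvPolynomial (Fin n) ℤ} (hR : SkewNonneg i j R) :
    SkewNonneg i j (R * (sumXErase i * sumXErase j)) := by
  rw [sumXErase_eq hij, sumXErase_eq hij.symm, Finset.erase_right_comm (a := j)]
  set T : MvPolynomial (Fin n) ℤ := ∑ k ∈ (Finset.univ.erase i).erase j, X k with hT
  have hmul : ∀ R, SkewNonneg i j R → SkewNonneg i j (R * T) := fun R hR =>
    hR.mul_sum_X _ (by simp) (by simp)
  have : R * ((T + X j) * (T + X i)) = R * T * T + R * T * (X i + X j) + R * (X i * X j) := by
    ring
  rw [this]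
  exact ((hmul _ (hmul _ hR)).add ((hmul _ hR).mul_X_add_X hij)).add (hR.mul_X_mul_X hij)

lemma avoidPoly_eq {i j : Fin n} (hij : i ≠ j) (c : Fin n → ℕ) :
    avoidPoly c = sumXErase i ^ c i * (sumXErase j ^ c j *
      ∏ v ∈ (Finset.univ.erase i).erase j, sumXErase v ^ c v) := by
  rw [Finset.mul_prod_erase (Finset.univ.erase i) (fun v => sumXErase v ^ c v) (by simp [hij.symm]),
    Finset.mul_prod_erase Finset.univ (fun v => sumXErase v ^ c v) (Finset.mem_univ i), avoidPoly]

/-- Moving one unit of multiplicity from `i` to a letter `j` of smaller multiplicity does not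
decrease the coefficients of monomials in which `i` and `j` have equal exponents. -/
lemma coeff_avoidPoly_le {i j : Fin n} (hij : i ≠ j) {c c' : Fin n → ℕ}
    (hi : c i = c' i + 1) (hj : c' j = c j + 1) (hc : ∀ v, v ≠ i → v ≠ j → c' v = c v)
    (hlt : c j < c i) {d : Fin n →₀ ℕ} (hd : d i = d j) :
    coeff d (avoidPoly c) ≤ coeff d (avoidPoly c') := by
  rw [← sub_nonneg, ← coeff_sub, avoidPoly_eq hij c, avoidPoly_eq hij c']
  have hrest : ∏ v ∈ (Finset.univ.erase i).erase j, sumXErase v ^ c' v =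
      ∏ v ∈ (Finset.univ.erase i).erase j, (sumXErase v ^ c v : MvPolynomial (Fin n) ℤ) := by
    refine Finset.prod_congr rfl fun v hv => ?_
    simp only [Finset.mem_erase] at hv
    rw [hc v hv.2.1 hv.1]
  obtain ⟨e, he⟩ : ∃ e, c' i = c j + e := ⟨c' i - c j, by omega⟩
  have hdiff : (sumXErase j - sumXErase i : MvPolynomial (Fin n) ℤ) = X i - X j := by
    rw [sumXErase_eq hij, sumXErase_eq hij.symm, Finset.erase_right_comm (a := j)]
    ring
  rw [hrest, hj, hi, he]
  have hfactor (P Q W : MvPolynomial (Fin n) ℤ) (b : ℕ) :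
      P ^ (b + e) * (Q ^ (b + 1) * W) - P ^ (b + e + 1) * (Q ^ b * W) =
        (Q - P) * (P * Q) ^ b * W * P ^ e := by
    rw [_root_.mul_pow]
    ring
  rw [hfactor, hdiff]
  refine coeff_mul_sumXErase_pow_nonneg (fun d hd => ?_) e d hd.ge
  refine SkewNonneg.coeff_nonneg_of_le ?_ hd
  refine SkewNonneg.mul_prod _ (fun v hv R hR => ?_) <|
    (SkewNonneg.X_sub_X hij).mul_pow (fun R => skewNonneg_mul_sumXErase_mul_sumXErase hij) _
  simp only [Finset.mem_erase] at hv
  exact hR.mul_pow (fun R => skewNonneg_mul_sumXErase hij hv.2.1 hv.1) _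

/-- Among multiplicities of a given total `m * n`, the constant ones maximize the coefficients
of monomials with constant exponents. -/
lemma coeff_avoidPoly_le_const (m : ℕ) {d : Fin n →₀ ℕ} (hd : ∀ i j, d i = d j)
    (c : Fin n → ℕ) (hc : ∑ v, c v = m * n) :
    coeff d (avoidPoly c) ≤ coeff d (avoidPoly fun _ => m) := by
  induction h : ∑ v, (c v - m) using Nat.strong_induction_on generalizing c with
  | _ N ih =>
  have hconst : ∑ _v : Fin n, m = m * n := by simp [mul_comm]
  by_cases hle : ∀ v, c v ≤ m
  · have := (Finset.sum_eq_sum_iff_of_le (s := Finset.univ) (f := c) (g := fun _ => m)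
      (fun v _ => hle v)).mp (hc.trans hconst.symm)
    have hcm : c = fun _ => m := _root_.funext fun v => this v (Finset.mem_univ v)
    rw [hcm]
  · push Not at hle
    obtain ⟨i, hi⟩ := hle
    obtain ⟨j, hj⟩ : ∃ j, c j < m := by
      by_contra! hge
      have : ∑ _v : Fin n, m < ∑ v, c v :=
        Finset.sum_lt_sum (fun v _ => hge v) ⟨i, Finset.mem_univ i, hi⟩
      omega
    have hij : i ≠ j := by rintro rfl; omega
    set c' : Fin n → ℕ := Function.update (Function.update c i (c i - 1)) j (c j + 1) with hc'
    have hi' : c' i = c i - 1 := by simp [hc', hij]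
    have hj' : c' j = c j + 1 := by simp [hc']
    have hrest : ∀ v, v ≠ i → v ≠ j → c' v = c v := fun v hvi hvj => by simp [hc', hvi, hvj]
    have hsplit (f : Fin n → ℕ) :
        ∑ v, f v = f i + (f j + ∑ v ∈ (Finset.univ.erase i).erase j, f v) := by
      rw [Finset.add_sum_erase _ f (by simp [hij.symm]),
        Finset.add_sum_erase _ f (Finset.mem_univ i)]
    have hsum (f : ℕ → ℕ) : ∑ v ∈ (Finset.univ.erase i).erase j, f (c' v) =
        ∑ v ∈ (Finset.univ.erase i).erase j, f (c v) := by
      refine Finset.sum_congr rfl fun v hv => ?_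
      simp only [Finset.mem_erase] at hv
      rw [hrest v hv.2.1 hv.1]
    refine (coeff_avoidPoly_le hij (by omega) hj' hrest (by omega) (hd i j)).trans
      (ih (∑ v, (c' v - m)) ?_ c' ?_ rfl)
    · have h1 := hsum (fun x => x - m)
      rw [hsplit fun v => c v - m] at h
      rw [hsplit fun v => c' v - m]
      simp only [hi', hj'] at h1 ⊢
      omega
    · have h1 := hsum id
      rw [hsplit] at hc ⊢
      simp only [id] at h1
      omega

lemma prod_X_eq_monomial {ι : Type*} [Fintype ι] (π : ι → Fin n) :
    ∏ t, (X (π t) : MvPolynomial (Fin n) ℤ) = monomial (∑ t, Finsupp.single (π t) 1) 1 := by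
  rw [monomial_sum_one]
  rfl

/-- The words with letter multiplicities `d` avoiding the word `g` are counted by a coefficient
of the polynomial `avoidPoly` of the multiplicities of `g`. -/
lemma card_avoiding_eq_coeff {ι : Type*} [Fintype ι] [DecidableEq ι] (g : ι → Fin n)
    (d : Fin n →₀ ℕ) :
    ((Finset.univ.filter fun π : ι → Fin n =>
      (∀ v, (Finset.univ.filter fun t => π t = v).card = d v) ∧ ∀ t, π t ≠ g t).card : ℤ) =
      coeff d (avoidPoly fun v => (Finset.univ.filter fun t => g t = v).card) := by
  have hprod : avoidPoly (fun v => (Finset.univ.filter fun t => g t = v).card) =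
      ∏ t, sumXErase (g t) := by
    rw [avoidPoly, ← Finset.prod_fiberwise Finset.univ g]
    refine Finset.prod_congr rfl fun v _ => ?_
    rw [Finset.prod_congr rfl fun t ht => by rw [(Finset.mem_filter.mp ht).2],
      Finset.prod_const]
  simp only [hprod, sumXErase]
  rw [Finset.prod_univ_sum, coeff_sum]
  simp only [prod_X_eq_monomial, coeff_monomial]
  rw [Finset.sum_boole, Nat.cast_inj]
  congr 1
  ext π
  simp only [Finset.mem_filter, Finset.mem_univ, true_and, Fintype.mem_piFinset,
    Finset.mem_erase, and_true, Finsupp.ext_iff, Finsupp.finsetSum_apply, Finsupp.single_apply,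
    Finset.card_filter]
  exact and_comm

end MvPolynomial

lemma feedback_eq_replicate {n N : ℕ} (G : List Bool → Fin n) (π : Fin N → Fin n)
    (h : ∀ t : Fin N, G (feedback G π t) ≠ π t) (t : ℕ) :
    feedback G π t = List.replicate t false := by
  induction t with
  | zero => rfl
  | succ t ih =>
    rw [feedback, List.replicate_succ', ih]
    congr 2
    split_ifs with ht
    · simpa [ih] using h ⟨t, ht⟩
    · rfl

lemma ne_of_guessScore_eq_zero {n N : ℕ} {G : List Bool → Fin n} {π : Fin N → Fin n}
    (h : guessScore G π = 0) (t : Fin N) : π t ≠ G (List.replicate t false) := by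
  have hG : ∀ t : Fin N, G (feedback G π t) ≠ π t := by
    simpa [guessScore, Finset.filter_eq_empty_iff] using h
  rw [← feedback_eq_replicate G π hG t]
  exact (hG t).symm

lemma avoidScore_eq_zero {m n : ℕ} {π : Fin (m * n) → Fin n}
    (h : ∀ t, (π t).1 ≠ t.1 % n) : avoidScore m n π = 0 := by
  rw [avoidScore, dif_neg]
  rintro ⟨t, ht⟩
  exact h t (Finset.mem_filter.mp ht).2

lemma card_filter_mod_eq {m n : ℕ} (hn : 0 < n) (v : Fin n) :
    (Finset.univ.filter fun t : Fin (m * n) => (⟨t.1 % n, Nat.mod_lt _ hn⟩ : Fin n) = v).card =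
      m := by
  have : (Finset.univ.filter fun t : Fin (m * n) => (⟨t.1 % n, Nat.mod_lt _ hn⟩ : Fin n) = v) =
      Finset.univ.image fun x : Fin m => finProdFinEquiv (x, v) := by
    ext t
    simp only [Finset.mem_filter, Finset.mem_univ, true_and, Finset.mem_image]
    constructor
    · rintro rfl
      exact ⟨t.divNat, finProdFinEquiv.apply_symm_apply t⟩
    · rintro ⟨x, rfl⟩
      ext
      simp [Nat.mod_eq_of_lt v.2]
  rw [this, Finset.card_image_of_injective _ fun x y hxy => by simpa using hxy]
  simp

/-- Among all deterministic Yes/No feedback strategies, the avoiding strategy maximizes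
the probability of scoring zero on a uniform deck of `S_{m,n}`. -/
theorem avoiding_maximizes_zero_probability (m n : ℕ) (hm : 0 < m) (hn : 0 < n)
    (G : List Bool → Fin n) :
    (((DeckSet m n).filter fun π => guessScore G π = 0).card : ℝ) / (DeckSet m n).card ≤
      (((DeckSet m n).filter fun π => avoidScore m n π = 0).card : ℝ) /
        (DeckSet m n).card := by
  let d : Fin n →₀ ℕ := Finsupp.equivFunOnFinite.symm fun _ => m
  let g : Fin (m * n) → Fin n := fun t => G (List.replicate t false)
  let a : Fin (m * n) → Fin n := fun t => ⟨t.1 % n, Nat.mod_lt _ hn⟩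
  have hle := MvPolynomial.coeff_avoidPoly_le_const m (d := d) (fun _ _ => rfl)
    (fun v => (Finset.univ.filter fun t => g t = v).card) (by
      rw [← Finset.card_eq_sum_card_fiberwise fun t _ => Finset.mem_coe.mpr (Finset.mem_univ _)]
      simp)
  have ha : (fun v => (Finset.univ.filter fun t => a t = v).card) = fun _ => m :=
    funext fun v => card_filter_mod_eq hn v
  rw [← ha, ← MvPolynomial.card_avoiding_eq_coeff, ← MvPolynomial.card_avoiding_eq_coeff,
    Nat.cast_le] at hle
  gcongr ?_ / _
  rw [Nat.cast_le]
  refine (Finset.card_le_card fun π hπ => ?_).trans (hle.trans (Finset.card_le_card fun π hπ => ?_))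
  · simp only [DeckSet, Finset.mem_filter, Finset.mem_univ, true_and] at hπ ⊢
    exact ⟨hπ.1, ne_of_guessScore_eq_zero hπ.2⟩
  · simp only [DeckSet, Finset.mem_filter, Finset.mem_univ, true_and] at hπ ⊢
    exact ⟨hπ.1, avoidScore_eq_zero fun t h => hπ.2 t (Fin.ext h)⟩
end
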